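/- Fix an odd prime power q. Let V be a finite-dimensional F_q-vector space of odd dimension 2n+1 with a nondegenerate symmetric bilinear form B, and let g be an isometry of (V, B) with det g = 1 whose minimal polynomial equals its characteristic polynomial f_g ∈ F_q[λ]. Then (λ + 1) does not divide f_g, and the multiplicity of (λ − 1) in f_g is odd (in particular (λ − 1) divides f_g). -/

import Mathlib

open Polynomial in
theorem aux_charpoly {F V : Type*} [Field F]
    [AddCommGroup V] [Module F V] [FiniteDimensional F V]
    (n : ℕ) (hdim : Module.finrank F V = 2 * n + 1)
    (B : LinearMap.BilinForm F V) (hnd : B.Nondegenerate)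
    (g : V ≃ₗ[F] V) (hg : ∀ x y : V, B (g x) (g y) = B x y)
    (hdet : LinearMap.det (g : V →ₗ[F] V) = 1) :
    LinearMap.charpoly (g : Module.End F V) =
      - (LinearMap.charpoly (g : Module.End F V)).reverse := by
  classical
  let b := Module.finBasisOfFinrankEq F V hdim
  set M := LinearMap.toMatrix b b (g : V →ₗ[F] V) with hM
  have hMc : M.charpoly = LinearMap.charpoly (g : Module.End F V) :=
    LinearMap.charpoly_toMatrix _ b
  have hMd : M.det = 1 := by rw [hM, LinearMap.det_toMatrix, hdet]
  set J := LinearMap.BilinForm.toMatrix b B with hJ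
  have hJd : J.det ≠ 0 :=
    (LinearMap.BilinForm.nondegenerate_iff_det_ne_zero b).1 hnd
  have hrel : M.transpose * J * M = J := by
    have h1 : B.comp (g : V →ₗ[F] V) (g : V →ₗ[F] V) = B := by
      ext x y; simp [hg]
    have h2 := LinearMap.BilinForm.toMatrix_comp b b B (g : V →ₗ[F] V) (g : V →ₗ[F] V)
    rw [h1] at h2
    exact h2.symm
  have hMu : IsUnit M := (Matrix.isUnit_iff_isUnit_det _).2 (by simp [hMd])
  have hMu' : IsUnit M.det := by simp [hMd]
  have hJu : IsUnit J := (Matrix.isUnit_iff_isUnit_det _).2 (isUnit_iff_ne_zero.2 hJd)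
  have h3 : M⁻¹.charpoly = M.charpoly := by
    obtain ⟨u, hu⟩ := hJu
    have h4 : M.transpose * J = J * M⁻¹ := by
      conv_rhs => rw [← hrel]
      rw [Matrix.mul_assoc _ M, Matrix.mul_nonsing_inv _ hMu', Matrix.mul_one]
    have h5 := Matrix.charpoly_units_conj u (M⁻¹)
    rw [hu, ← h4, ← hu, Matrix.mul_assoc, Matrix.mul_nonsing_inv _
      (by rw [hu]; exact isUnit_iff_ne_zero.2 hJd), Matrix.mul_one, Matrix.charpoly_transpose] at h5
    exact h5.symm
  have h6 := Matrix.charpoly_inv M hMu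
  rw [h3, hMd, ← Matrix.reverse_charpoly, hMc] at h6
  simpa [pow_succ, pow_mul] using h6

open Polynomial in
theorem aux_odd {F : Type*} [Field F] (h2 : (2 : F) ≠ 0) (f : F[X]) (hf0 : f ≠ 0)
    (hf : f = - f.reverse) : Odd (f.rootMultiplicity 1) := by
  obtain ⟨h, hh, hnd⟩ := exists_eq_pow_rootMultiplicity_mul_and_not_dvd f hf0 1
  set m := f.rootMultiplicity 1
  by_contra hm
  rw [Nat.not_odd_iff_even] at hm
  have hrp : ∀ k : ℕ, ((X - C (1:F)) ^ k).reverse = (-1) ^ k * (X - C (1:F)) ^ k := by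
    have h1 : (X - C (1:F)).reverse = -1 * (X - C 1) := by
      ext i
      rcases i with _ | _ | i
      · rw [coeff_zero_reverse, leadingCoeff_X_sub_C]; simp
      · rw [coeff_one_reverse, nextCoeff_X_sub_C]; simp [coeff_one]
      · rw [coeff_eq_zero_of_natDegree_lt, coeff_eq_zero_of_natDegree_lt]
        · rw [neg_one_mul, natDegree_neg, natDegree_X_sub_C]; omega
        · have := reverse_natDegree_le (X - C (1:F))
          rw [natDegree_X_sub_C] at this; omega
    intro k
    induction k with
    | zero =>
      have : (1 : F[X]).reverse = 1 := reverse_C 1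
      simp [this]
    | succ k ih => rw [pow_succ, reverse_mul_of_domain, ih, h1]; ring
  rw [hh, reverse_mul_of_domain, hrp, hm.neg_one_pow, one_mul, ← mul_neg] at hf
  have h3 := mul_left_cancel₀ (pow_ne_zero _ (X_sub_C_ne_zero 1)) hf
  apply hnd
  rw [dvd_iff_isRoot, IsRoot.def]
  have h4 : h.reverse.eval 1 = h.eval 1 := by
    letI : Invertible (1:F) := invertibleOne
    have := eval₂_reverse_mul_pow (RingHom.id F) (1:F) h
    simpa using this
  have h5 : h.eval 1 = - h.eval 1 := by
    conv_lhs => rw [h3, eval_neg, h4]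
  have h6 : 2 * h.eval 1 = 0 := by linear_combination h5
  simpa [h2] using h6

theorem aux_even {F V : Type*} [Field F] (h2 : (2 : F) ≠ 0)
    [AddCommGroup V] [Module F V] [FiniteDimensional F V]
    (B : LinearMap.BilinForm F V) (hnd : B.Nondegenerate) (D : V →ₗ[F] V)
    (hs : ∀ x y, B x (D y) = - B y (D x)) : Even (Module.finrank F (LinearMap.range D)) := by
  classical
  obtain ⟨U, hU⟩ := Submodule.exists_isCompl (LinearMap.ker D)
  have hr := LinearMap.finrank_range_add_finrank_ker D
  have hu := Submodule.finrank_add_eq_of_isCompl hU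
  have : Module.finrank F (LinearMap.range D) = Module.finrank F U := by omega
  rw [this]
  let C0 : LinearMap.BilinForm F U := B.comp U.subtype (D ∘ₗ U.subtype)
  have hC : ∀ x y : U, C0 x y = B x (D y) := fun x y => rfl
  have hl : ∀ x : U, (∀ y, C0 y x = 0) → x = 0 := by
    intro x hx
    have h1 : D x = 0 := by
      apply hnd.2
      intro v
      obtain ⟨k, hk, u, hu, rfl⟩ := Submodule.mem_sup.1
        (show v ∈ LinearMap.ker D ⊔ U by rw [hU.sup_eq_top]; trivial)
      have hk' : D k = 0 := hk
      have := hx ⟨u, hu⟩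
      rw [hC] at this
      rw [hs, map_add, hk', zero_add, ← hs]
      exact this
    have : (x : V) ∈ LinearMap.ker D ⊓ U := ⟨h1, x.2⟩
    rw [hU.inf_eq_bot] at this
    exact Subtype.ext this
  have hsC : ∀ x y, C0 x y = - C0 y x := fun x y => by rw [hC, hC, hs]
  have hCn : C0.Nondegenerate := by
    refine ⟨fun x hx => hl x fun y => ?_, hl⟩
    rw [hsC, hx, neg_zero]
  let b := Module.finBasis F U
  have hd := (LinearMap.BilinForm.nondegenerate_iff_det_ne_zero b).1 hCn
  have ht : (LinearMap.BilinForm.toMatrix b C0).transpose = - LinearMap.BilinForm.toMatrix b C0 := by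
    ext i j
    simp only [Matrix.transpose_apply, Matrix.neg_apply, LinearMap.BilinForm.toMatrix_apply]
    exact hsC _ _
  by_contra ho
  rw [Nat.not_even_iff_odd] at ho
  have h3 := congrArg Matrix.det ht
  rw [Matrix.det_transpose, Matrix.det_neg, Fintype.card_fin, ho.neg_one_pow] at h3
  have h6 : 2 * (LinearMap.BilinForm.toMatrix b C0).det = 0 := by linear_combination h3
  rcases mul_eq_zero.1 h6 with h | h
  · exact h2 h
  · exact hd h

open Polynomial in
theorem aux_ker {F V : Type*} [Field F]
    [AddCommGroup V] [Module F V] [FiniteDimensional F V]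
    (g : Module.End F V) (hcyc : minpoly F g = g.charpoly) (p : F[X]) (hp : p ≠ 0) :
    Module.finrank F V ≤ Module.finrank F (LinearMap.range (aeval g p)) + p.natDegree := by
  have hinv : ∀ x ∈ LinearMap.range (aeval g p), g x ∈ LinearMap.range (aeval g p) := by
    rintro _ ⟨y, rfl⟩
    refine ⟨g y, ?_⟩
    have : Commute (aeval g p) g := by
      have h := Polynomial.aeval_X (R := F) g
      conv_rhs => rw [← h]
      exact (Commute.all p X).map (aeval g)
    exact LinearMap.congr_fun this y
  let r := g.restrict hinv
  have hr : ∀ (s : F[X]) (x), ((aeval r s x : LinearMap.range (aeval g p)) : V) = aeval g s (x : V) := by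
    intro s x
    induction s using Polynomial.induction_on' with
    | add a b ha hb => simp [ha, hb]
    | monomial k a =>
      simp only [aeval_monomial, Module.End.mul_apply, Module.algebraMap_end_apply]
      have : r ^ k = (g ^ k).restrict (fun x hx => Module.End.pow_apply_mem_of_forall_mem k hinv x hx) :=
        Module.End.pow_restrict k hinv
      rw [this]; rfl
  have h0 : aeval g (r.charpoly * p) = 0 := by
    ext x
    rw [map_mul, Module.End.mul_apply]
    have := hr r.charpoly ⟨aeval g p x, x, rfl⟩
    rw [LinearMap.aeval_self_charpoly] at this
    simpa using this.symm
  have h1 := natDegree_le_of_dvd (minpoly.dvd F g h0) (mul_ne_zero r.charpoly_monic.ne_zero hp)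
  rwa [hcyc, LinearMap.charpoly_natDegree, natDegree_mul r.charpoly_monic.ne_zero hp,
    LinearMap.charpoly_natDegree] at h1

/-- Let `V` be a `(2n+1)`-dimensional space over `F_q` (`q`
odd) with a nondegenerate symmetric bilinear form `B`, and let `g` be an
isometry of determinant `1` whose minimal polynomial equals its characteristic
polynomial `f_g`.  Then `(λ + 1)` does not divide `f_g`, and the multiplicity of
`(λ - 1)` in `f_g` is odd (in particular `(λ - 1) ∣ f_g`). -/
theorem stmt17 {F V : Type*} [Field F] [Fintype F] (hodd : Odd (Fintype.card F))
    [AddCommGroup V] [Module F V] [FiniteDimensional F V]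
    (n : ℕ) (hdim : Module.finrank F V = 2 * n + 1)
    (B : LinearMap.BilinForm F V) (hsymm : ∀ x y : V, B x y = B y x)
    (hnd : B.Nondegenerate)
    (g : V ≃ₗ[F] V) (hg : ∀ x y : V, B (g x) (g y) = B x y)
    (hdet : LinearMap.det (g : V →ₗ[F] V) = 1)
    (fg : Polynomial F) (hfg : fg = LinearMap.charpoly (g : Module.End F V))
    (hcyc : minpoly F (g : Module.End F V) = fg) :
    ¬ (Polynomial.X + 1 ∣ fg) ∧ Odd (fg.rootMultiplicity 1) := by
  have h2 : (2 : F) ≠ 0 := by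
    apply Ring.two_ne_zero
    intro hc
    have := FiniteField.even_card_of_char_two hc
    rw [Nat.odd_iff] at hodd
    omega
  have hodd1 : Odd (fg.rootMultiplicity 1) := by
    apply aux_odd h2
    · rw [hfg]; exact (LinearMap.charpoly_monic _).ne_zero
    · rw [hfg]; exact aux_charpoly n hdim B hnd g hg hdet
  refine ⟨fun hdvd => ?_, hodd1⟩
  set G : Module.End F V := (g : Module.End F V) with hG
  have heig : ∀ a : F, fg.IsRoot a → ∃ v : V, v ≠ 0 ∧ g v = a • v := by
    intro a ha
    rw [hfg] at ha
    have h := (Module.End.hasEigenvalue_iff_isRoot_charpoly G a).2 ha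
    obtain ⟨v, hv⟩ := h.exists_hasEigenvector
    exact ⟨v, hv.2, hv.apply_eq_smul⟩
  obtain ⟨v, hv0, hv⟩ := heig 1 (by
    have : fg.rootMultiplicity 1 ≠ 0 := fun h => by rw [h] at hodd1; simp at hodd1
    by_contra h
    exact this (Polynomial.rootMultiplicity_eq_zero h))
  obtain ⟨w, hw0, hw⟩ := heig (-1) (by
    rw [← Polynomial.dvd_iff_isRoot]; simpa using hdvd)
  let D : V →ₗ[F] V := (g : V →ₗ[F] V) - (g.symm : V →ₗ[F] V)
  have hD : ∀ x, D x = g x - g.symm x := fun x => rfl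
  have hadj : ∀ x y, B x (g y) = B (g.symm x) y := fun x y => by
    rw [← hg (g.symm x) y, LinearEquiv.apply_symm_apply]
  have hev := aux_even h2 B hnd D (fun x y => by
    rw [hD, hD, map_sub, map_sub, hadj x y, hsymm x (g.symm y), ← hadj y x, hsymm (g.symm x) y]
    ring)
  have hrk := aux_ker G (hcyc.trans hfg) (Polynomial.X ^ 2 - Polynomial.C 1)
    (Polynomial.X_pow_sub_C_ne_zero (by norm_num) 1)
  rw [Polynomial.natDegree_X_pow_sub_C] at hrk
  have hrange : LinearMap.range (Polynomial.aeval G (Polynomial.X ^ 2 - Polynomial.C (1:F)))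
      ≤ LinearMap.range D := by
    rintro _ ⟨x, rfl⟩
    refine ⟨g x, ?_⟩
    rw [hD]
    simp [pow_two, hG]
  have hle := Submodule.finrank_mono hrange
  have hrn := LinearMap.finrank_range_add_finrank_ker D
  have hsv : g.symm v = v := by rw [LinearEquiv.symm_apply_eq, hv, one_smul]
  have hsw : g.symm w = -w := by rw [LinearEquiv.symm_apply_eq, map_neg, hw]; simp
  have hvk : v ∈ LinearMap.ker D := by
    rw [LinearMap.mem_ker, hD, hv, hsv]; simp
  have hwk : w ∈ LinearMap.ker D := by
    rw [LinearMap.mem_ker, hD, hw, hsw]; simp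
  have hk1 : Module.finrank F (LinearMap.ker D) ≤ 1 := by
    obtain ⟨r, hr⟩ := hev
    omega
  obtain ⟨z, hz⟩ := finrank_le_one_iff.1 hk1
  obtain ⟨c, hc⟩ := hz ⟨v, hvk⟩
  obtain ⟨d, hd⟩ := hz ⟨w, hwk⟩
  have hc' : c • (z : V) = v := congrArg Subtype.val hc
  have hd' : d • (z : V) = w := congrArg Subtype.val hd
  have h7 : d • v = c • w := by rw [← hc', ← hd', smul_comm]
  have h8 := congrArg g h7
  rw [map_smul, map_smul, hv, hw, one_smul, neg_one_smul, smul_neg, ← h7] at h8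
  have h9 : (2 : F) • (d • v) = 0 := by
    rw [two_smul]; nth_rewrite 1 [h8]; simp
  rcases smul_eq_zero.1 h9 with h | h
  · exact h2 h
  · rcases smul_eq_zero.1 h with h | h
    · exact hw0 (by rw [← hd', h, zero_smul])
    · exact hv0 h
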